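/- arXiv:math/9910167 — 7 statements merged into one kernel-verified Lean document; each statement's English description precedes it below -/
import Mathlib

section
/- Let λ, μ : ℕ → ℝ be antitone sequences of nonnegative real numbers, each summable. Then λ = μ if and only if for every integer n ≥ 1 the sums of n-th powers agree: ∑ₖ λₖⁿ = ∑ₖ μₖⁿ. -/
theorem pow_succ_le_of_antitone {a : ℕ → ℝ} (ha : Antitone a) (ha0 : ∀ k, 0 ≤ a k)
    (n k : ℕ) : a k ^ (n + 1) ≤ a 0 ^ n * a k := by
  rw [pow_succ]
  exact mul_le_mul_of_nonneg_right (pow_le_pow_left₀ (ha0 k) (ha (Nat.zero_le k)) n) (ha0 k)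

theorem summable_pow_succ_of_antitone {a : ℕ → ℝ} (ha : Antitone a) (ha0 : ∀ k, 0 ≤ a k)
    (has : Summable a) (n : ℕ) : Summable fun k => a k ^ (n + 1) :=
  (has.mul_left (a 0 ^ n)).of_nonneg_of_le (fun k => pow_nonneg (ha0 k) _)
    (pow_succ_le_of_antitone ha ha0 n)

/-- The power sums of a nonnegative antitone summable sequence control its leading term. -/
theorem Antitone.apply_zero_le_of_tsum_pow_le {a b : ℕ → ℝ} (ha : Antitone a) (hb : Antitone b)
    (ha0 : ∀ k, 0 ≤ a k) (hb0 : ∀ k, 0 ≤ b k)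
    (has : Summable a) (hbs : Summable b)
    (h : ∀ n : ℕ, ∑' k, a k ^ (n + 1) ≤ ∑' k, b k ^ (n + 1)) : a 0 ≤ b 0 := by
  by_contra! hlt
  have hpos : 0 < a 0 := (hb0 0).trans_lt hlt
  have key (n : ℕ) : a 0 ^ (n + 1) ≤ b 0 ^ n * ∑' k, b k := by
    have hle := pow_succ_le_of_antitone hb hb0 n
    have hs : Summable fun k => b 0 ^ n * b k := hbs.mul_left _
    calc a 0 ^ (n + 1) ≤ ∑' k, a k ^ (n + 1) :=
          (summable_pow_succ_of_antitone ha ha0 has n).le_tsum 0 fun k _ => pow_nonneg (ha0 k) _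
      _ ≤ ∑' k, b k ^ (n + 1) := h n
      _ ≤ ∑' k, b 0 ^ n * b k :=
          (summable_pow_succ_of_antitone hb hb0 hbs n).tsum_le_tsum hle hs
      _ = b 0 ^ n * ∑' k, b k := tsum_mul_left
  have hlim := (tendsto_pow_atTop_nhds_zero_of_lt_one (div_nonneg (hb0 0) hpos.le)
    ((div_lt_one hpos).2 hlt)).mul_const (∑' k, b k)
  rw [zero_mul] at hlim
  obtain ⟨n, hn⟩ := (hlim.eventually_lt_const hpos).exists
  refine (key n).not_gt ?_
  rwa [div_pow, div_mul_eq_mul_div, div_lt_iff₀ (by positivity), ← pow_succ'] at hn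

/-- Two antitone summable sequences of nonnegative reals are equal iff
all their power sums (for `n ≥ 1`) agree.  (Proposition 2.1.4 of the paper: the eigenvalue
list of a positive trace-class operator is determined by the traces of its powers.) -/
theorem stmt2 (l m : ℕ → ℝ)
    (hl : Antitone l) (hm : Antitone m)
    (hl0 : ∀ k, 0 ≤ l k) (hm0 : ∀ k, 0 ≤ m k)
    (hls : Summable l) (hms : Summable m) :
    l = m ↔ ∀ n : ℕ, 1 ≤ n → ∑' k, (l k) ^ n = ∑' k, (m k) ^ n := by
  refine ⟨fun h n _ => by rw [h], fun h => funext fun k => ?_⟩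
  have hlp := summable_pow_succ_of_antitone hl hl0 hls
  have hmp := summable_pow_succ_of_antitone hm hm0 hms
  induction k using Nat.strong_induction_on with
  | _ k ih =>
    have tail (n : ℕ) : ∑' i, l (i + k) ^ (n + 1) = ∑' i, m (i + k) ^ (n + 1) := by
      have hsum := h (n + 1) (Nat.le_add_left 1 n)
      rw [← (hlp n).sum_add_tsum_nat_add k, ← (hmp n).sum_add_tsum_nat_add k,
        Finset.sum_congr rfl fun i hi => by rw [ih i (Finset.mem_range.1 hi)]] at hsum
      exact add_left_cancel hsum
    have hl' : Antitone fun i => l (i + k) := fun i j hij => hl (Nat.add_le_add_right hij k)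
    have hm' : Antitone fun i => m (i + k) := fun i j hij => hm (Nat.add_le_add_right hij k)
    have hls' := (summable_nat_add_iff k).2 hls
    have hms' := (summable_nat_add_iff k).2 hms
    have hle := hl'.apply_zero_le_of_tsum_pow_le hm' (fun i => hl0 (i + k)) (fun i => hm0 (i + k))
      hls' hms' fun n => (tail n).le
    have hge := hm'.apply_zero_le_of_tsum_pow_le hl' (fun i => hm0 (i + k)) (fun i => hl0 (i + k))
      hms' hls' fun n => (tail n).ge
    simpa using le_antisymm hle hge
end

section
/- Let H be a separable complex Hilbert space and let A and B be positive compact operators on H, diagonalized as follows: there are Hilbert (orthonormal) bases (eₖ)ₖ∈ℕ and (fₖ)ₖ∈ℕ of H and antitone nonnegative sequences λ, μ : ℕ → ℝ with A eₖ = λₖ eₖ and B fₖ = μₖ fₖ for all k. Suppose further that (gₖ)ₖ∈ℕ is a Hilbert basis of H and ν : ℕ → ℝ a sequence with (A − B) gₖ = νₖ gₖ for all k. Then ∑ₖ |λₖ − μₖ| ≤ ∑ₖ |νₖ|, as an inequality of (possibly infinite) sums in the extended nonnegative reals. In particular, if A − B is trace class then the ℓ¹-distance between the eigenvalue lists of A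 and B is at most trace|A − B|. -/
section WeylTraceInequality

variable {𝕜 H : Type*} [RCLike 𝕜] [NormedAddCommGroup H] [InnerProductSpace 𝕜 H]

/-- The quadratic form of a symmetric operator diagonalized by a Hilbert basis. -/
theorem HilbertBasis.hasSum_re_inner_apply_self {ι : Type*} (b : HilbertBasis ι 𝕜 H)
    {T : H →L[𝕜] H} (hT : T.IsSymmetric) {c : ι → ℝ} (hc : ∀ i, T (b i) = (c i : 𝕜) • b i)
    (x : H) :
    HasSum (fun i => c i * ‖inner 𝕜 (b i) x‖ ^ 2) (RCLike.re (inner 𝕜 x (T x))) := by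
  have h := RCLike.hasSum_re 𝕜 (b.hasSum_inner_mul_inner x (T x))
  refine h.congr_fun fun i => ?_
  have h1 : inner 𝕜 (b i) (T x) = (c i : 𝕜) * inner 𝕜 (b i) x := by
    have := hT (b i) x
    simp only [ContinuousLinearMap.coe_coe] at this
    rw [← this, hc, inner_smul_left, RCLike.conj_ofReal]
  rw [h1, mul_left_comm, RCLike.re_ofReal_mul, ← inner_conj_symm x (b i), RCLike.conj_mul]
  norm_cast

/-- Parseval's identity. -/
theorem HilbertBasis.hasSum_sq_norm_inner {ι : Type*} (b : HilbertBasis ι 𝕜 H) (x : H) :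
    HasSum (fun i => ‖inner 𝕜 (b i) x‖ ^ 2) (‖x‖ ^ 2) := by
  have h := b.hasSum_re_inner_apply_self (T := ContinuousLinearMap.id 𝕜 H)
    (fun _ _ => rfl) (c := fun _ => 1) (by simp) x
  simpa [inner_self_eq_norm_sq] using h

/-- On the span of the first `k + 1` eigenvectors, the quadratic form is bounded below by the
`k`-th eigenvalue. -/
theorem HilbertBasis.mul_sq_norm_le_re_inner_apply_self (b : HilbertBasis ℕ 𝕜 H)
    {T : H →L[𝕜] H} (hT : T.IsSymmetric) {c : ℕ → ℝ} (hc : ∀ i, T (b i) = (c i : 𝕜) • b i)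
    (hanti : Antitone c) {k : ℕ} {x : H}
    (hx : x ∈ Submodule.span 𝕜 (Set.range fun i : Fin (k + 1) => b i)) :
    c k * ‖x‖ ^ 2 ≤ RCLike.re (inner 𝕜 x (T x)) := by
  refine hasSum_le (fun i => ?_) ((b.hasSum_sq_norm_inner x).mul_left (c k))
    (b.hasSum_re_inner_apply_self hT hc x)
  rcases le_or_gt i k with hik | hik
  · exact mul_le_mul_of_nonneg_right (hanti hik) (sq_nonneg _)
  · have h0 : inner 𝕜 (b i) x = 0 := by
      induction hx using Submodule.span_induction with
      | mem y hy =>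
        obtain ⟨j, rfl⟩ := hy
        exact b.orthonormal.2 (by have := j.2; omega)
      | zero => simp
      | add y z _ _ hy hz => rw [inner_add_right, hy, hz, add_zero]
      | smul a y _ hy => rw [inner_smul_right, hy, mul_zero]
    simp [h0]

/-- Ky Fan's maximum principle. -/
theorem HilbertBasis.sum_re_inner_apply_self_le (b : HilbertBasis ℕ 𝕜 H)
    {T : H →L[𝕜] H} (hT : T.IsSymmetric) {c : ℕ → ℝ} (hc : ∀ i, T (b i) = (c i : 𝕜) • b i)
    (hanti : Antitone c) {n : ℕ} {u : Fin n → H} (hu : Orthonormal 𝕜 u) :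
    ∑ k, RCLike.re (inner 𝕜 (u k) (T (u k))) ≤ ∑ k : Fin n, c k := by
  have h1 := hasSum_sum (s := Finset.univ) fun k _ =>
    b.hasSum_re_inner_apply_self hT hc (u k)
  have h2 := (hasSum_sum (s := Finset.univ) fun k _ =>
    b.hasSum_sq_norm_inner (u k)).mul_left (c n)
  have h3 : HasSum (fun i => if i ∈ Finset.range n then c i - c n else 0)
      (∑ i ∈ Finset.range n, (c i - c n)) := by
    have := hasSum_sum_of_ne_finset_zero (L := .unconditional ℕ) (s := Finset.range n)
      (f := fun i => if i ∈ Finset.range n then c i - c n else 0) (fun i hi => if_neg hi)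
    rwa [Finset.sum_congr rfl fun i hi => if_pos hi] at this
  have hle := hasSum_le (fun i => ?_) h1 (h2.add h3)
  · refine hle.trans_eq ?_
    simp [hu.1, Finset.sum_range, mul_comm]
  · have hw : ∑ k, ‖inner 𝕜 (b i) (u k)‖ ^ 2 ≤ 1 := by
      have := hu.sum_inner_products_le (x := b i) (s := Finset.univ)
      simpa [b.orthonormal.1, norm_inner_symm (b i)] using this
    have hw0 : 0 ≤ ∑ k, ‖inner 𝕜 (b i) (u k)‖ ^ 2 := by positivity
    rw [← Finset.mul_sum]
    split_ifs with hi
    · have := hanti (Finset.mem_range.1 hi).le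
      nlinarith
    · have := hanti (not_lt.1 fun h => hi (Finset.mem_range.2 h))
      nlinarith

/-- Subspaces `W k` of dimension greater than `k` contain an orthonormal system of
representatives. -/
theorem Submodule.exists_orthonormal_mem (W : ℕ → Submodule 𝕜 H)
    (hW : ∀ k, k < Module.finrank 𝕜 (W k)) (n : ℕ) :
    ∃ u : Fin n → H, Orthonormal 𝕜 u ∧ ∀ k : Fin n, u k ∈ W k := by
  induction n with
  | zero => exact ⟨Fin.elim0, ⟨fun i => i.elim0, fun i => i.elim0⟩, fun i => i.elim0⟩
  | succ n ih =>
    obtain ⟨u, hu, huW⟩ := ih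
    have : FiniteDimensional 𝕜 (W n) := Module.finite_of_finrank_pos (by have := hW n; omega)
    let φ : W n →ₗ[𝕜] (Fin n → 𝕜) :=
      LinearMap.pi fun i => (innerSL 𝕜 (u i)).toLinearMap ∘ₗ (W n).subtype
    have hker : LinearMap.ker φ ≠ ⊥ := LinearMap.ker_ne_bot_of_finrank_lt (by simpa using hW n)
    obtain ⟨x, hx, hx0⟩ := Submodule.exists_mem_ne_zero_of_ne_bot hker
    have hx0' : (x : H) ≠ 0 := by simpa using hx0
    have horth (i : Fin n) : inner 𝕜 (u i) (x : H) = 0 := congrFun (LinearMap.mem_ker.1 hx) i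
    refine ⟨Fin.snoc u ((‖(x : H)‖⁻¹ : 𝕜) • (x : H)), ⟨fun i => ?_, fun i j hij => ?_⟩,
      fun i => ?_⟩
    · refine Fin.lastCases ?_ (fun i => ?_) i
      · simpa using norm_smul_inv_norm (𝕜 := 𝕜) hx0'
      · simpa using hu.1 i
    · induction i using Fin.lastCases with
      | last =>
        induction j using Fin.lastCases with
        | last => exact absurd rfl hij
        | cast j => simp [inner_smul_left, inner_eq_zero_symm.1 (horth j)]
      | cast i =>
        induction j using Fin.lastCases with
        | last => simp [inner_smul_right, horth i]
        | cast j => simpa using hu.2 fun h => hij (congrArg _ h)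
    · induction i using Fin.lastCases with
      | last => simpa using (W n).smul_mem _ x.2
      | cast i => simpa using huW i

/-- The one-sided Lidskii-type inequality: the positive parts of the eigenvalue differences are
controlled by the positive part of the spectrum of the difference. -/
theorem HilbertBasis.sum_posPart_sub_le_tsum_posPart (e f g : HilbertBasis ℕ 𝕜 H)
    {A B : H →L[𝕜] H} (hA : A.IsSymmetric) (hB : B.IsSymmetric) {l m ν : ℕ → ℝ}
    (hAe : ∀ k, A (e k) = (l k : 𝕜) • e k) (hBf : ∀ k, B (f k) = (m k : 𝕜) • f k)
    (hABg : ∀ k, (A - B) (g k) = (ν k : 𝕜) • g k)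
    (hl : Antitone l) (hm : Antitone m) (hν : Summable fun k => (ν k)⁺) (n : ℕ) :
    ∑ k ∈ Finset.range n, (l k - m k)⁺ ≤ ∑' k, (ν k)⁺ := by
  let b (k : ℕ) : HilbertBasis ℕ 𝕜 H := if m k ≤ l k then e else f
  have hspan (k : ℕ) :
      Module.finrank 𝕜 (Submodule.span 𝕜 (Set.range fun i : Fin (k + 1) => b k i)) = k + 1 := by
    simpa [Function.comp_def] using finrank_span_eq_card
      ((b k).orthonormal.linearIndependent.comp (fun i : Fin (k + 1) => (i : ℕ))
        Fin.val_injective)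
  obtain ⟨u, hu, huW⟩ := Submodule.exists_orthonormal_mem
    (fun k => Submodule.span 𝕜 (Set.range fun i : Fin (k + 1) => b k i))
    (fun k => by rw [hspan]; exact k.lt_succ_self) n
  have hAB : (A - B).IsSymmetric := by
    rw [ContinuousLinearMap.toLinearMap_sub]
    exact hA.sub hB
  have hsum (k : Fin n) : Summable fun j => (ν j)⁺ * ‖inner 𝕜 (g j) (u k)‖ ^ 2 := by
    refine Summable.of_nonneg_of_le (fun j => by positivity) (fun j => ?_) hν
    refine mul_le_of_le_one_right (posPart_nonneg _) ?_
    have := norm_inner_le_norm (𝕜 := 𝕜) (g j) (u k)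
    rw [g.orthonormal.1, hu.1, one_mul] at this
    exact pow_le_one₀ (norm_nonneg _) this
  have hterm (k : Fin n) : m k + (l k - m k)⁺ ≤ RCLike.re (inner 𝕜 (u k) (B (u k))) +
      ∑' j, (ν j)⁺ * ‖inner 𝕜 (g j) (u k)‖ ^ 2 := by
    have hk := huW k
    dsimp only [b] at hk
    split_ifs at hk with hml
    · have h1 := e.mul_sq_norm_le_re_inner_apply_self hA hAe hl hk
      have h2 := hasSum_le (fun j => mul_le_mul_of_nonneg_right (le_posPart (ν j)) (sq_nonneg _))
        (g.hasSum_re_inner_apply_self hAB hABg (u k)) (hsum k).hasSum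
      rw [sub_apply, inner_sub_right, map_sub] at h2
      rw [hu.1, one_pow, mul_one] at h1
      rw [posPart_of_nonneg (sub_nonneg.2 hml)]
      linarith
    · have h1 := f.mul_sq_norm_le_re_inner_apply_self hB hBf hm hk
      have h2 : 0 ≤ ∑' j, (ν j)⁺ * ‖inner 𝕜 (g j) (u k)‖ ^ 2 :=
        tsum_nonneg fun j => by positivity
      rw [hu.1, one_pow, mul_one] at h1
      rw [posPart_of_nonpos (sub_nonpos.2 (not_le.1 hml).le)]
      linarith
  have hD : ∑ k : Fin n, ∑' j, (ν j)⁺ * ‖inner 𝕜 (g j) (u k)‖ ^ 2 ≤ ∑' j, (ν j)⁺ := by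
    rw [← Summable.tsum_finsetSum fun k _ => hsum k]
    refine Summable.tsum_le_tsum (fun j => ?_) (summable_sum fun k _ => hsum k) hν
    have := hu.sum_inner_products_le (x := g j) (s := Finset.univ)
    rw [← Finset.mul_sum]
    refine mul_le_of_le_one_right (posPart_nonneg _) ?_
    simpa [g.orthonormal.1, norm_inner_symm (g j)] using this
  have hKF := f.sum_re_inner_apply_self_le hB hBf hm hu
  have htot := Finset.sum_le_sum fun k (_ : k ∈ Finset.univ) => hterm k
  rw [Finset.sum_add_distrib, Finset.sum_add_distrib] at htot
  rw [Finset.sum_range]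
  linarith

end WeylTraceInequality


/-- Weyl-type inequality, Proposition 2.2 of the paper.  If `A`, `B` are
positive compact operators on a separable complex Hilbert space, diagonalized by Hilbert
bases `e`, `f` with antitone nonnegative eigenvalue sequences `l`, `m`, and `A - B` is
diagonalized by a Hilbert basis `g` with eigenvalue sequence `ν`, then
`∑ₖ |lₖ - mₖ| ≤ ∑ₖ |νₖ|` in the extended nonnegative reals. -/
theorem stmt3 {H : Type*} [NormedAddCommGroup H] [InnerProductSpace ℂ H] [CompleteSpace H]
    (A B : H →L[ℂ] H)
    (hA : A.IsPositive) (hA' : IsCompactOperator A)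
    (hB : B.IsPositive) (hB' : IsCompactOperator B)
    (e f g : HilbertBasis ℕ ℂ H)
    (l m ν : ℕ → ℝ)
    (hl : Antitone l) (hm : Antitone m)
    (hl0 : ∀ k, 0 ≤ l k) (hm0 : ∀ k, 0 ≤ m k)
    (hAe : ∀ k, A (e k) = l k • e k)
    (hBf : ∀ k, B (f k) = m k • f k)
    (hABg : ∀ k, (A - B) (g k) = ν k • g k) :
    ∑' k, ENNReal.ofReal |l k - m k| ≤ ∑' k, ENNReal.ofReal |ν k| := by
  by_cases htop : ∑' k, ENNReal.ofReal |ν k| = ⊤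
  · exact htop ▸ le_top
  have habs : Summable fun k => |ν k| := by
    have := ENNReal.summable_toReal htop
    simpa using this
  have hpos : Summable fun k => (ν k)⁺ :=
    habs.of_nonneg_of_le (fun k => posPart_nonneg _) fun k => by
      rw [← posPart_add_negPart]; exact le_add_of_nonneg_right (negPart_nonneg _)
  have hneg : Summable fun k => (-ν k)⁺ :=
    habs.of_nonneg_of_le (fun k => posPart_nonneg _) fun k => by
      rw [← posPart_add_negPart, negPart_def]; exact le_add_of_nonneg_left (posPart_nonneg _)
  have hBAg : ∀ k, (B - A) (g k) = ((-ν k : ℝ) : ℂ) • g k := fun k => by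
    rw [← neg_sub, neg_apply, hABg, Complex.coe_smul, neg_smul]
  rw [← ENNReal.ofReal_tsum_of_nonneg (fun k => abs_nonneg _) habs]
  refine ENNReal.tsum_le_of_sum_range_le fun n => ?_
  rw [← ENNReal.ofReal_sum_of_nonneg fun k _ => abs_nonneg _]
  refine ENNReal.ofReal_le_ofReal ?_
  have h1 := e.sum_posPart_sub_le_tsum_posPart f g hA.isSymmetric hB.isSymmetric
    hAe hBf hABg hl hm hpos n
  have h2 := f.sum_posPart_sub_le_tsum_posPart e g hB.isSymmetric hA.isSymmetric
    hBf hAe hBAg hm hl hneg n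
  calc ∑ k ∈ Finset.range n, |l k - m k|
      = ∑ k ∈ Finset.range n, (l k - m k)⁺ + ∑ k ∈ Finset.range n, (m k - l k)⁺ := by
        rw [← Finset.sum_add_distrib]
        refine Finset.sum_congr rfl fun k _ => ?_
        rw [← posPart_add_negPart, negPart_def, neg_sub, posPart_def (m k - l k)]
    _ ≤ ∑' k, (ν k)⁺ + ∑' k, (-ν k)⁺ := add_le_add h1 h2
    _ = ∑' k, |ν k| := by
        rw [← hpos.tsum_add hneg]
        refine tsum_congr fun k => ?_
        rw [← posPart_add_negPart, negPart_def, posPart_def (-ν k)]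
end

section
/- Let A and B be Hermitian n×n complex matrices. Let λ↓(A) and λ↓(B) denote their real eigenvalues, counted with multiplicity and arranged in decreasing order, and let ν₁, …, νₙ be the eigenvalues of A − B counted with multiplicity. Then ∑ₖ₌₁ⁿ |λ↓(A)ₖ − λ↓(B)ₖ| ≤ ∑ₖ₌₁ⁿ |νₖ|. -/
open Polynomial

open Matrix ComplexOrder

/-- Two families with the same multiset of values differ by a bijection of their index types. -/
theorem exists_equiv_comp_eq_of_map_univ_eq {ι κ α : Type*} [Fintype ι] [Fintype κ]
    {f : ι → α} {g : κ → α}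
    (h : Multiset.map f Finset.univ.val = Multiset.map g Finset.univ.val) :
    ∃ e : ι ≃ κ, g ∘ e = f := by
  classical
  have hcard (a : α) : Fintype.card {i // f i = a} = Fintype.card {j // g j = a} := by
    have := congrArg (Multiset.count a) h
    rw [Multiset.count_map, Multiset.count_map] at this
    simpa only [Fintype.card_subtype, Finset.card_def, Finset.filter_val, eq_comm] using this
  exact ⟨Equiv.ofFiberEquiv fun a => Fintype.equivOfCardEq (hcard a),
    funext fun i => Equiv.ofFiberEquiv_map _ i⟩

/-- A Hermitian matrix is unitarily similar to the diagonal matrix of any enumeration of the roots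
of its characteristic polynomial. -/
theorem exists_unitary_eq_conj_diagonal {n : ℕ} {A : Matrix (Fin n) (Fin n) ℂ}
    (hA : A.IsHermitian) {p : Fin n → ℝ} (hp : A.charpoly = ∏ k, (X - C (p k : ℂ))) :
    ∃ U : Matrix (Fin n) (Fin n) ℂ, Uᴴ * U = 1 ∧ A = U * diagonal (fun k => (p k : ℂ)) * Uᴴ := by
  obtain ⟨σ, hσ⟩ : ∃ σ : Equiv.Perm (Fin n), hA.eigenvalues ∘ σ = p := by
    have h := congrArg roots (hp.symm.trans hA.charpoly_eq)
    rw [roots_prod _ _ (Finset.prod_ne_zero_iff.2 fun _ _ => X_sub_C_ne_zero _),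
      roots_prod _ _ (Finset.prod_ne_zero_iff.2 fun _ _ => X_sub_C_ne_zero _)] at h
    simp only [roots_X_sub_C, Multiset.bind_singleton] at h
    obtain ⟨σ, hσ⟩ := exists_equiv_comp_eq_of_map_univ_eq h
    exact ⟨σ, funext fun k => Complex.ofReal_injective (congrFun hσ k)⟩
  set V : Matrix (Fin n) (Fin n) ℂ := hA.eigenvectorUnitary.1
  have hVV : Vᴴ * V = 1 := Unitary.coe_star_mul_self hA.eigenvectorUnitary
  refine ⟨V.submatrix id σ, ?_, ?_⟩
  · rw [conjTranspose_submatrix, ← Equiv.coe_refl, submatrix_mul_equiv, hVV, submatrix_one_equiv]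
  · have h := hA.spectral_theorem
    rw [Unitary.conjStarAlgAut_apply] at h
    have : diagonal (fun k => (p k : ℂ)) =
        (diagonal (RCLike.ofReal ∘ hA.eigenvalues : Fin n → ℂ)).submatrix σ σ := by
      rw [submatrix_diagonal_equiv, ← hσ]; rfl
    rw [this, conjTranspose_submatrix, submatrix_mul_equiv, submatrix_mul_equiv, submatrix_id_id]
    exact h

/-- The quadratic form of `U * diagonal p * Uᴴ`. -/
theorem re_dotProduct_conj_diagonal_mulVec {n : ℕ} (U : Matrix (Fin n) (Fin n) ℂ) (p : Fin n → ℝ)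
    (x : Fin n → ℂ) :
    (star x ⬝ᵥ ((U * diagonal (fun k => (p k : ℂ)) * Uᴴ) *ᵥ x)).re =
      ∑ k, p k * Complex.normSq ((Uᴴ *ᵥ x) k) := by
  rw [← mulVec_mulVec, ← mulVec_mulVec, dotProduct_mulVec, ← conjTranspose_conjTranspose U,
    ← star_mulVec, conjTranspose_conjTranspose]
  simp [dotProduct, mulVec_diagonal, Complex.normSq_apply]
  exact Finset.sum_congr rfl fun _ _ => by ring

/-- **Weyl's monotonicity principle**: the ordered eigenvalues of a Hermitian matrix are monotone
in the Loewner order. -/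
theorem le_of_posSemidef_sub {n : ℕ} {U V : Matrix (Fin n) (Fin n) ℂ} {p q : Fin n → ℝ}
    (hU : Uᴴ * U = 1) (hV : Vᴴ * V = 1) (hp : Antitone p) (hq : Antitone q)
    (h : (V * diagonal (fun k => (q k : ℂ)) * Vᴴ -
      U * diagonal (fun k => (p k : ℂ)) * Uᴴ).PosSemidef) : p ≤ q := by
  intro k
  let L : (Fin n → ℂ) →ₗ[ℂ] ({i : Fin n // i ≠ k} → ℂ) :=
    LinearMap.pi fun i => LinearMap.proj (i : Fin n) ∘ₗ
      (if (i : Fin n) < k then Vᴴ else Uᴴ).mulVecLin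
  have hL : LinearMap.ker L ≠ ⊥ := by
    apply LinearMap.ker_ne_bot_of_finrank_lt
    have := Fintype.card_subtype_lt (p := fun i : Fin n => i ≠ k) (x := k) (by simp)
    simpa only [Module.finrank_fintype_fun_eq_card] using this
  obtain ⟨x, hx, hx0⟩ := (Submodule.ne_bot_iff _).1 hL
  have hxV : ∀ i < k, (Vᴴ *ᵥ x) i = 0 := fun i hi => by
    simpa [L, hi] using congrFun (LinearMap.mem_ker.1 hx) ⟨i, hi.ne⟩
  have hxU : ∀ i > k, (Uᴴ *ᵥ x) i = 0 := fun i hi => by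
    simpa [L, hi.not_gt] using congrFun (LinearMap.mem_ker.1 hx) ⟨i, hi.ne'⟩
  have norm_eq : ∀ W : Matrix (Fin n) (Fin n) ℂ, Wᴴ * W = 1 →
      ∑ i, Complex.normSq ((Wᴴ *ᵥ x) i) = (star x ⬝ᵥ x).re := fun W hW => by
    have := re_dotProduct_conj_diagonal_mulVec W 1 x
    simpa [mul_eq_one_comm.1 hW] using this.symm
  have hpos : 0 < (star x ⬝ᵥ x).re :=
    (Complex.pos_iff.1 (dotProduct_star_self_pos_iff.2 hx0)).1
  have h_re := h.re_dotProduct_nonneg x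
  rw [sub_mulVec, dotProduct_sub, map_sub, sub_nonneg] at h_re
  have h_form : ∑ i, p i * Complex.normSq ((Uᴴ *ᵥ x) i) ≤
      ∑ i, q i * Complex.normSq ((Vᴴ *ᵥ x) i) := by
    simp only [← re_dotProduct_conj_diagonal_mulVec]
    exact h_re
  refine le_of_mul_le_mul_right ?_ hpos
  calc p k * (star x ⬝ᵥ x).re = ∑ i, p k * Complex.normSq ((Uᴴ *ᵥ x) i) := by
        rw [← norm_eq U hU, Finset.mul_sum]
    _ ≤ ∑ i, p i * Complex.normSq ((Uᴴ *ᵥ x) i) := Finset.sum_le_sum fun i _ => by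
        rcases le_or_gt i k with hi | hi
        · exact mul_le_mul_of_nonneg_right (hp hi) (Complex.normSq_nonneg _)
        · simp [hxU i hi]
    _ ≤ ∑ i, q i * Complex.normSq ((Vᴴ *ᵥ x) i) := h_form
    _ ≤ ∑ i, q k * Complex.normSq ((Vᴴ *ᵥ x) i) := Finset.sum_le_sum fun i _ => by
        rcases lt_or_ge i k with hi | hi
        · simp [hxV i hi]
        · exact mul_le_mul_of_nonneg_right (hq hi) (Complex.normSq_nonneg _)
    _ = q k * (star x ⬝ᵥ x).re := by rw [← norm_eq V hV, Finset.mul_sum]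

theorem trace_conj_diagonal {n : ℕ} {U : Matrix (Fin n) (Fin n) ℂ} (hU : Uᴴ * U = 1)
    (p : Fin n → ℝ) :
    (U * diagonal (fun k => (p k : ℂ)) * Uᴴ).trace = ((∑ k, p k : ℝ) : ℂ) := by
  rw [trace_mul_comm, ← Matrix.mul_assoc, hU, Matrix.one_mul, trace_diagonal, Complex.ofReal_sum]

theorem posSemidef_conj_diagonal {n : ℕ} (U : Matrix (Fin n) (Fin n) ℂ) {p : Fin n → ℝ}
    (hp : 0 ≤ p) : (U * diagonal (fun k => (p k : ℂ)) * Uᴴ).PosSemidef :=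
  (PosSemidef.diagonal fun k => by simpa using hp k).mul_mul_conjTranspose_same U

/-- The characteristic polynomial of a Hermitian matrix splits over a decreasing family of reals. -/
theorem exists_antitone_charpoly_eq {n : ℕ} {A : Matrix (Fin n) (Fin n) ℂ} (hA : A.IsHermitian) :
    ∃ p : Fin n → ℝ, Antitone p ∧ A.charpoly = ∏ k, (X - C (p k : ℂ)) := by
  have hmono := Tuple.monotone_sort (-hA.eigenvalues)
  refine ⟨hA.eigenvalues ∘ Tuple.sort (-hA.eigenvalues), fun i j hij => ?_, ?_⟩
  · simpa using hmono hij
  · rw [hA.charpoly_eq]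
    exact (Equiv.prod_comp (Tuple.sort (-hA.eigenvalues))
      fun k => X - C (hA.eigenvalues k : ℂ)).symm

/-- finite-dimensional Weyl inequality.  For Hermitian `n × n` complex
matrices `A`, `B`, if `p` and `q` are the decreasingly ordered eigenvalue sequences of `A`
and `B` (counted with multiplicity, encoded via the characteristic polynomials), and `ν`
enumerates the eigenvalues of `A - B` with multiplicity, then
`∑ₖ |pₖ - qₖ| ≤ ∑ₖ |νₖ|`. -/
theorem stmt4 {n : ℕ} (A B : Matrix (Fin n) (Fin n) ℂ)
    (hA : A.IsHermitian) (hB : B.IsHermitian)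
    (p q ν : Fin n → ℝ)
    (hp : Antitone p) (hq : Antitone q)
    (hpA : A.charpoly = ∏ k : Fin n, (X - C ((p k : ℝ) : ℂ)))
    (hqB : B.charpoly = ∏ k : Fin n, (X - C ((q k : ℝ) : ℂ)))
    (hν : (A - B).charpoly = ∏ k : Fin n, (X - C ((ν k : ℝ) : ℂ))) :
    ∑ k : Fin n, |p k - q k| ≤ ∑ k : Fin n, |ν k| := by
  obtain ⟨U, hU, hAU⟩ := exists_unitary_eq_conj_diagonal hA hpA
  obtain ⟨V, hV, hBV⟩ := exists_unitary_eq_conj_diagonal hB hqB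
  obtain ⟨W, hW, hABW⟩ := exists_unitary_eq_conj_diagonal (hA.sub hB) hν
  set N : Matrix (Fin n) (Fin n) ℂ := W * diagonal (fun k => ((ν⁻ k : ℝ) : ℂ)) * Wᴴ with hN
  set P : Matrix (Fin n) (Fin n) ℂ := W * diagonal (fun k => ((ν⁺ k : ℝ) : ℂ)) * Wᴴ with hP
  have hNpos : N.PosSemidef := posSemidef_conj_diagonal W (negPart_nonneg ν)
  have hPpos : P.PosSemidef := posSemidef_conj_diagonal W (posPart_nonneg ν)
  have hsub : A - B = P - N := by
    rw [hABW, hP, hN, ← Matrix.sub_mul, ← Matrix.mul_sub, diagonal_sub]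
    congr! 4 with k
    exact_mod_cast (congrFun (posPart_sub_negPart ν) k).symm
  have hBP : A + N = B + P := by
    rw [add_comm B, ← sub_eq_sub_iff_add_eq_add, hsub]
  have hD : (A + N).IsHermitian := hA.add hNpos.isHermitian
  obtain ⟨d, hd, hdD⟩ := exists_antitone_charpoly_eq hD
  obtain ⟨Y, hY, hDY⟩ := exists_unitary_eq_conj_diagonal hD hdD
  have hpd : p ≤ d := le_of_posSemidef_sub hU hY hp hd (by
    rw [← hDY, ← hAU, add_sub_cancel_left]; exact hNpos)
  have hqd : q ≤ d := le_of_posSemidef_sub hV hY hq hd (by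
    rw [← hDY, ← hBV, hBP, add_sub_cancel_left]; exact hPpos)
  have htrA : ∑ k, d k = ∑ k, p k + ∑ k, ν⁻ k := by
    have h := congrArg trace hDY
    rw [trace_add, trace_conj_diagonal hY, hAU, trace_conj_diagonal hU, hN,
      trace_conj_diagonal hW] at h
    exact_mod_cast h.symm
  have htrB : ∑ k, d k = ∑ k, q k + ∑ k, ν⁺ k := by
    have h := congrArg trace (hBP.symm.trans hDY)
    rw [trace_add, trace_conj_diagonal hY, hBV, trace_conj_diagonal hV, hP,
      trace_conj_diagonal hW] at h
    exact_mod_cast h.symm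
  calc ∑ k, |p k - q k| ≤ ∑ k, ((d k - p k) + (d k - q k)) := Finset.sum_le_sum fun k _ => by
        have := hpd k
        have := hqd k
        rw [abs_le]
        constructor <;> linarith
    _ = ∑ k, ν⁺ k + ∑ k, ν⁻ k := by
        simp only [Finset.sum_add_distrib, Finset.sum_sub_distrib]
        linarith
    _ = ∑ k, |ν k| := by
        rw [← Finset.sum_add_distrib]
        exact Finset.sum_congr rfl fun k _ => posPart_add_negPart (ν k)
end

section
/- Let λ, μ : ℕ → ℝ be antitone summable sequences of nonnegative real numbers, and suppose the doubly indexed families of pairwise products coincide up to rearrangement: there exists a bijection σ : ℕ×ℕ → ℕ×ℕ such that μᵢ·μⱼ = λ_{(σ(i,j))₁}·λ_{(σ(i,j))₂} for all i, j ∈ ℕ. Then λ = μ. -/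
/-- The powers of a nonnegative summable sequence are summable. -/
theorem summable_pow_succ_of_nonneg {a : ℕ → ℝ} (ha0 : ∀ k, 0 ≤ a k) (has : Summable a) (n : ℕ) :
    Summable fun k => a k ^ (n + 1) := by
  induction n with
  | zero => simpa using has
  | succ n ih =>
    exact (ih.mul_of_nonneg has (fun k => pow_nonneg (ha0 k) _) ha0 |>.comp_injective
      (i := fun k : ℕ => (k, k)) fun _ _ h => (Prod.ext_iff.mp h).1).congr
        fun k => (pow_succ (a k) (n + 1)).symm

/-- If the power sums of `b` are bounded by those of the antitone sequence `a`, then the first term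
of `b` is at most that of `a`. -/
theorem head_le_of_tsum_pow_le {a b : ℕ → ℝ} (ha : Antitone a)
    (ha0 : ∀ k, 0 ≤ a k) (hb0 : ∀ k, 0 ≤ b k) (has : Summable a) (hbs : Summable b)
    (h : ∀ n, ∑' k, b k ^ (n + 1) ≤ ∑' k, a k ^ (n + 1)) : b 0 ≤ a 0 := by
  by_contra! hlt
  have hb : 0 < b 0 := (ha0 0).trans_lt hlt
  have key (n : ℕ) : b 0 ≤ (a 0 / b 0) ^ n * ∑' k, a k := by
    have h₁ : b 0 ^ (n + 1) ≤ a 0 ^ n * ∑' k, a k := calc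
      b 0 ^ (n + 1) ≤ ∑' k, b k ^ (n + 1) :=
        (summable_pow_succ_of_nonneg hb0 hbs n).le_tsum 0 fun k _ => pow_nonneg (hb0 k) _
      _ ≤ ∑' k, a k ^ (n + 1) := h n
      _ ≤ ∑' k, a 0 ^ n * a k :=
        (summable_pow_succ_of_nonneg ha0 has n).tsum_le_tsum (fun k => by
          rw [pow_succ]
          exact mul_le_mul_of_nonneg_right
            (pow_le_pow_left₀ (ha0 k) (ha (Nat.zero_le k)) n) (ha0 k)) (has.mul_left _)
      _ = a 0 ^ n * ∑' k, a k := tsum_mul_left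
    rw [div_pow, div_mul_eq_mul_div, le_div_iff₀ (pow_pos hb n)]
    rwa [pow_succ'] at h₁
  have hlim := (tendsto_pow_atTop_nhds_zero_of_lt_one (div_nonneg (ha0 0) hb.le)
    ((div_lt_one hb).2 hlt)).mul_const (∑' k, a k)
  rw [zero_mul] at hlim
  exact hb.not_ge (ge_of_tendsto' hlim key)

/-- An antitone summable nonnegative sequence is determined by its power sums. -/
theorem eq_of_tsum_pow_eq {a b : ℕ → ℝ} (ha : Antitone a) (hb : Antitone b)
    (ha0 : ∀ k, 0 ≤ a k) (hb0 : ∀ k, 0 ≤ b k) (has : Summable a) (hbs : Summable b)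
    (h : ∀ n, ∑' k, a k ^ (n + 1) = ∑' k, b k ^ (n + 1)) : a = b := by
  funext k
  induction k using Nat.strong_induction_on with
  | _ k ih =>
    have htail (n : ℕ) : ∑' i, a (i + k) ^ (n + 1) = ∑' i, b (i + k) ^ (n + 1) := by
      have h₁ := (summable_pow_succ_of_nonneg ha0 has n).sum_add_tsum_nat_add k
      have h₂ := (summable_pow_succ_of_nonneg hb0 hbs n).sum_add_tsum_nat_add k
      have h₃ : ∑ i ∈ Finset.range k, a i ^ (n + 1) = ∑ i ∈ Finset.range k, b i ^ (n + 1) :=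
        Finset.sum_congr rfl fun i hi => by rw [ih i (Finset.mem_range.1 hi)]
      linarith [h n]
    have hak : Summable fun i => a (i + k) := (summable_nat_add_iff k).2 has
    have hbk : Summable fun i => b (i + k) := (summable_nat_add_iff k).2 hbs
    have hba := head_le_of_tsum_pow_le (a := fun i => a (i + k)) (b := fun i => b (i + k))
      (fun i j hij => ha (by lia)) (fun _ => ha0 _) (fun _ => hb0 _) hak hbk
      fun n => (htail n).ge
    have hab := head_le_of_tsum_pow_le (a := fun i => b (i + k)) (b := fun i => a (i + k))
      (fun i j hij => hb (by lia)) (fun _ => hb0 _) (fun _ => ha0 _) hbk hak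
      fun n => (htail n).le
    simp only [zero_add] at hba hab
    exact le_antisymm hab hba

/-- The power sums of the family of pairwise products are the squares of the power sums. -/
theorem tsum_mul_pow_eq_sq {a : ℕ → ℝ} (ha0 : ∀ k, 0 ≤ a k) (has : Summable a) (n : ℕ) :
    ∑' p : ℕ × ℕ, (a p.1 * a p.2) ^ (n + 1) = (∑' k, a k ^ (n + 1)) ^ 2 := by
  have hs := summable_pow_succ_of_nonneg ha0 has n
  have hnn (k : ℕ) : 0 ≤ a k ^ (n + 1) := pow_nonneg (ha0 k) _
  simp_rw [mul_pow]
  rw [sq, hs.tsum_mul_tsum hs (hs.mul_of_nonneg hs hnn hnn)]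

/-- If `l`, `m` are antitone summable sequences of nonnegative reals
whose doubly indexed families of pairwise products coincide up to a rearrangement
(a bijection of `ℕ × ℕ`), then `l = m`.  (In operator terms: if positive trace-class
operators `A`, `B` satisfy `Λ(A ⊗ A) = Λ(B ⊗ B)`, then `Λ(A) = Λ(B)`.) -/
theorem stmt5 (l m : ℕ → ℝ)
    (hl : Antitone l) (hm : Antitone m)
    (hl0 : ∀ k, 0 ≤ l k) (hm0 : ∀ k, 0 ≤ m k)
    (hls : Summable l) (hms : Summable m)
    (σ : ℕ × ℕ ≃ ℕ × ℕ)
    (hσ : ∀ i j : ℕ, m i * m j = l (σ (i, j)).1 * l (σ (i, j)).2) :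
    l = m := by
  refine eq_of_tsum_pow_eq hl hm hl0 hm0 hls hms fun n => ?_
  rw [← sq_eq_sq₀ (tsum_nonneg fun k => pow_nonneg (hl0 k) _)
    (tsum_nonneg fun k => pow_nonneg (hm0 k) _), ← tsum_mul_pow_eq_sq hl0 hls,
    ← tsum_mul_pow_eq_sq hm0 hms, ← σ.tsum_eq]
  exact tsum_congr fun p => by rw [hσ p.1 p.2]
end

section
/- Let H be a complex Hilbert space, let α : B(H) → B(H) be a unital star-algebra homomorphism of the algebra of bounded linear operators on H, and let u, v ∈ B(H) satisfy α(x)∘u = u∘x and α(x)∘v = v∘x for every x ∈ B(H). Then v*∘u is a scalar multiple of the identity: there exists c ∈ ℂ with v*∘u = c·I. -/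
/-- If `α` is a unital star-algebra endomorphism of `B(H)` and
`u`, `v` are intertwiners (`α(x)u = ux` and `α(x)v = vx` for all `x ∈ B(H)`), then
`v*u` is a scalar multiple of the identity. -/
theorem stmt6 {H : Type*} [NormedAddCommGroup H] [InnerProductSpace ℂ H] [CompleteSpace H]
    (α : (H →L[ℂ] H) →⋆ₐ[ℂ] (H →L[ℂ] H))
    (u v : H →L[ℂ] H)
    (hu : ∀ x : H →L[ℂ] H, α x * u = u * x)
    (hv : ∀ x : H →L[ℂ] H, α x * v = v * x) :
    ∃ c : ℂ, (ContinuousLinearMap.adjoint v) * u = c • (1 : H →L[ℂ] H) := by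
  rw [← ContinuousLinearMap.star_eq_adjoint]
  have hv_star (x : H →L[ℂ] H) : star v * α x = x * star v := by
    simpa [map_star] using congrArg star (hv (star x))
  have h_center : star v * u ∈ Subalgebra.center ℂ (H →L[ℂ] H) := by
    rw [Subalgebra.mem_center_iff]
    intro x
    rw [← mul_assoc, ← hv_star, mul_assoc, hu, mul_assoc]
  rw [Algebra.IsCentral.center_eq_bot, Algebra.mem_bot] at h_center
  obtain ⟨c, hc⟩ := h_center
  exact ⟨c, by rw [← hc, Algebra.algebraMap_eq_smul_one]⟩
end

section
/- Let M be a von Neumann algebra on a complex Hilbert space H and let U be a unitary operator on H such that U*xU ∈ M for every x ∈ M. Define E_α = {v ∈ M : (U*xU)∘v = v∘x for all x ∈ M} and E_β = {w ∈ M′ : (UyU*)∘w = w∘y for all y ∈ M′}, where M′ denotes the commutant of M. Then U·E_α = E_β: for every v ∈ E_α the operator U∘v belongs to E_β, and conversely every w ∈ E_β equals U∘v for the element v = U*∘w, which belongs to E_α. -/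
/-- Let `M` be a von Neumann algebra on a complex Hilbert space `H` and
`U` a unitary with `U*MU ⊆ M`.  With `E_α` the intertwiner space of `Ad(U*)|_M` and `E_β`
the intertwiner space of `Ad(U)|_{M'}`, one has `U·E_α = E_β`: `Uv ∈ E_β` for each
`v ∈ E_α`, and each `w ∈ E_β` equals `U(U*w)` with `U*w ∈ E_α`. -/
theorem stmt7 {H : Type*} [NormedAddCommGroup H] [InnerProductSpace ℂ H] [CompleteSpace H]
    (M : VonNeumannAlgebra H)
    (U : H →L[ℂ] H) (hU : U ∈ unitary (H →L[ℂ] H))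
    (hMU : ∀ x ∈ M, star U * x * U ∈ M) :
    (∀ v : H →L[ℂ] H,
      (v ∈ M ∧ ∀ x ∈ M, (star U * x * U) * v = v * x) →
        (U * v ∈ M.commutant ∧
          ∀ y ∈ M.commutant, (U * y * star U) * (U * v) = (U * v) * y)) ∧
    (∀ w : H →L[ℂ] H,
      (w ∈ M.commutant ∧ ∀ y ∈ M.commutant, (U * y * star U) * w = w * y) →
        ((star U * w ∈ M ∧
            ∀ x ∈ M, (star U * x * U) * (star U * w) = (star U * w) * x) ∧
          w = U * (star U * w))) := by
  have h₁ : ∀ a : H →L[ℂ] H, star U * (U * a) = a := fun a => by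
    rw [← mul_assoc, Unitary.star_mul_self_of_mem hU, one_mul]
  have h₂ : ∀ a : H →L[ℂ] H, U * (star U * a) = a := fun a => by
    rw [← mul_assoc, Unitary.mul_star_self_of_mem hU, one_mul]
  constructor
  · rintro v ⟨hv, hx⟩
    refine ⟨VonNeumannAlgebra.mem_commutant_iff.2 fun x hxM => ?_, fun y hy => ?_⟩
    · have h := congrArg (U * ·) (hx x hxM)
      simpa only [mul_assoc, h₂] using h
    · have h := VonNeumannAlgebra.mem_commutant_iff.1 hy v hv
      simp only [mul_assoc, h₁, h]
  · rintro w ⟨hw, hy⟩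
    refine ⟨⟨?_, fun x hxM => ?_⟩, (h₂ w).symm⟩
    · rw [← M.commutant_commutant]
      refine VonNeumannAlgebra.mem_commutant_iff.2 fun y hyM => ?_
      have h := congrArg (star U * ·) (hy y hyM)
      simpa only [mul_assoc, h₁] using h
    · have h := VonNeumannAlgebra.mem_commutant_iff.1 hw x hxM
      simp only [mul_assoc, h₂, h]
end

section
/- Let M be a von Neumann algebra on a complex Hilbert space H and let U : ℝ → B(H) be a one-parameter group of unitary operators (U_{s+t} = U_s∘U_t for all s,t ∈ ℝ, U_0 = I) such that U_t*∘x∘U_t ∈ M for every x ∈ M and every t ≥ 0. For t ≥ 0 set E(t) = {v ∈ M : (U_t*∘x∘U_t)∘v = v∘x for all x ∈ M}. Then for all s, t ≥ 0: (i) if v ∈ E(t) and w ∈ E(s), then v∘w ∈ E(s+t); and (ii) for v ∈ E(t) and w ∈ E(s), one has U_{s+t}∘(v∘w) = (U_s∘w)∘(U_t∘v); that is, the maps θ_t : v ↦ U_t∘v reverse multiplication: θ_{s+t}(vw) = θ_s(w)·θ_t(v). -/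
/-- For a unitary `u`, an operator `v` intertwines `x` with `u* x u` iff `u v` commutes with `x`. -/
theorem conj_mul_eq_iff_commute {A : Type*} [Monoid A] [StarMul A] {u : A} (hu : u ∈ unitary A)
    (v x : A) : (star u * x * u) * v = v * x ↔ Commute x (u * v) := by
  constructor
  · intro h
    calc x * (u * v) = (u * star u) * x * (u * v) := by
          rw [Unitary.mul_star_self_of_mem hu, one_mul]
      _ = u * ((star u * x * u) * v) := by simp only [mul_assoc]
      _ = u * v * x := by rw [h, mul_assoc]
  · intro h
    calc (star u * x * u) * v = star u * (x * (u * v)) := by simp only [mul_assoc]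
      _ = (star u * u) * (v * x) := by rw [h.eq]; simp only [mul_assoc]
      _ = v * x := by rw [Unitary.star_mul_self_of_mem hu, one_mul]

/-- Let `M` be a von Neumann algebra on `H` and `U` a one-parameter
unitary group with `Uₜ* M Uₜ ⊆ M` for `t ≥ 0`.  With
`E(t) = {v ∈ M : (Uₜ* x Uₜ) v = v x for all x ∈ M}`, one has for `s, t ≥ 0`:
(i) `v ∈ E(t)`, `w ∈ E(s)` imply `vw ∈ E(s+t)`; and (ii) the maps `θₜ : v ↦ Uₜ v`
reverse multiplication: `U_{s+t}(vw) = (U_s w)(U_t v)`. -/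
theorem stmt8 {H : Type*} [NormedAddCommGroup H] [InnerProductSpace ℂ H] [CompleteSpace H]
    (M : VonNeumannAlgebra H)
    (U : ℝ → (H →L[ℂ] H))
    (hU : ∀ t : ℝ, U t ∈ unitary (H →L[ℂ] H))
    (hgrp : ∀ s t : ℝ, U (s + t) = U s * U t)
    (h0 : U 0 = 1)
    (hMU : ∀ t : ℝ, 0 ≤ t → ∀ x ∈ M, star (U t) * x * U t ∈ M) :
    ∀ s t : ℝ, 0 ≤ s → 0 ≤ t → ∀ v w : H →L[ℂ] H,
      (v ∈ M ∧ ∀ x ∈ M, (star (U t) * x * U t) * v = v * x) →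
      (w ∈ M ∧ ∀ x ∈ M, (star (U s) * x * U s) * w = w * x) →
        ((v * w ∈ M ∧
            ∀ x ∈ M, (star (U (s + t)) * x * U (s + t)) * (v * w) = (v * w) * x) ∧
          U (s + t) * (v * w) = (U s * w) * (U t * v)) := by
  rintro s t - - v w ⟨hvM, hv⟩ ⟨hwM, hw⟩
  have hv' : ∀ x ∈ M, Commute x (U t * v) := fun x hx =>
    (conj_mul_eq_iff_commute (hU t) v x).1 (hv x hx)
  have hw' : ∀ x ∈ M, Commute x (U s * w) := fun x hx =>
    (conj_mul_eq_iff_commute (hU s) w x).1 (hw x hx)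
  have hmul : U (s + t) * (v * w) = (U s * w) * (U t * v) := by
    calc U (s + t) * (v * w) = U s * ((U t * v) * w) := by rw [hgrp]; simp only [mul_assoc]
      _ = (U s * w) * (U t * v) := by rw [← (hv' w hwM).eq, mul_assoc]
  refine ⟨⟨mul_mem hvM hwM, fun x hx => ?_⟩, hmul⟩
  rw [conj_mul_eq_iff_commute (hU (s + t)), hmul]
  exact (hw' x hx).mul_right (hv' x hx)
end
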